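/- arXiv:2305.01221 — 2 statements merged into one kernel-verified Lean document; each statement's English description precedes it below -/
import Mathlib

section
/- Let n ≥ 2 and μ ∈ ℝ^{n+1}. Every element σ of Γ_A(μ) satisfies the type-A Pohozaev identity for μ, i.e. ∑_{i=1}^{n+1} σ_i² − ∑_{i=1}^{n+1} σ_i σ_{i+1} = 2∑_{i=1}^{n+1} μ_i σ_i (with σ_{n+2} = σ_1). -/
open Finset

/-- The generalized Cartan matrix of type `A_n^{(1)}`, with indices read cyclically
(`K i i = 2`, `K i j = -1` when `i,j` are cyclically adjacent, `0` otherwise). -/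
noncomputable def affA (n : ℕ) (i j : ZMod (n + 1)) : ℝ :=
  if i = j then 2 else if i = j + 1 ∨ j = i + 1 then -1 else 0

/-- The affine reflection `ℜ_i` associated to `μ`:
`(ℜ_i σ)_i = 2 μ_i - ∑_t K_{i t} σ_t + σ_i` and `(ℜ_i σ)_j = σ_j` for `j ≠ i`. -/
noncomputable def reflA (n : ℕ) (μ : ZMod (n + 1) → ℝ) (i : ZMod (n + 1))
    (σ : ZMod (n + 1) → ℝ) : ZMod (n + 1) → ℝ :=
  Function.update σ i (2 * μ i - ∑ t : ZMod (n + 1), affA n i t * σ t + σ i)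

/-- `Γ_A(μ)`: the smallest subset of `ℝ^{n+1}` containing `0` and closed under all `ℜ_i`. -/
inductive GammaA (n : ℕ) (μ : ZMod (n + 1) → ℝ) : (ZMod (n + 1) → ℝ) → Prop
  | zero : GammaA n μ 0
  | refl (i : ZMod (n + 1)) (σ : ZMod (n + 1) → ℝ) :
      GammaA n μ σ → GammaA n μ (reflA n μ i σ)

lemma sum_sq_add_single {ι : Type*} [Fintype ι] [DecidableEq ι] (σ : ι → ℝ) (i : ι) (d : ℝ) :
    ∑ j, (σ j + if j = i then d else 0) ^ 2 = ∑ j, σ j ^ 2 + (2 * d * σ i + d ^ 2) := by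
  have h : ∀ j, (σ j + if j = i then d else 0) ^ 2
      = σ j ^ 2 + if j = i then 2 * d * σ j + d ^ 2 else 0 := by
    intro j
    split_ifs <;> ring
  simp [h, sum_add_distrib]

lemma sum_mul_add_single {ι : Type*} [Fintype ι] [DecidableEq ι] (μ σ : ι → ℝ) (i : ι) (d : ℝ) :
    ∑ j, μ j * (σ j + if j = i then d else 0) = ∑ j, μ j * σ j + μ i * d := by
  simp [mul_add, sum_add_distrib]

lemma sum_mul_shift_add_single {G : Type*} [AddCommGroup G] [Fintype G] [DecidableEq G]
    (σ : G → ℝ) (i g : G) (hg : g ≠ 0) (d : ℝ) :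
    ∑ j, (σ j + if j = i then d else 0) * (σ (j + g) + if j + g = i then d else 0)
      = ∑ j, σ j * σ (j + g) + d * (σ (i + g) + σ (i - g)) := by
  have h : ∀ j, (σ j + if j = i then d else 0) * (σ (j + g) + if j + g = i then d else 0)
      = σ j * σ (j + g) + ((if j = i then d * σ (j + g) else 0)
        + if j = i - g then d * σ j else 0) := by
    intro j
    have hj : j + g = i ↔ j = i - g := eq_sub_iff_add_eq.symm
    simp only [hj]
    by_cases h1 : j = i
    · have h2 : j ≠ i - g := by
        rw [h1]
        intro h
        exact hg (sub_eq_self.mp h.symm)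
      simp only [h1, if_true] at h2 ⊢
      simp only [h2, if_false]
      ring
    · simp only [h1, if_false]
      split_ifs <;> ring
  simp only [h, sum_add_distrib, sum_ite_eq', mem_univ, if_true]
  ring

lemma sum_affA_mul (n : ℕ) (hn : 2 ≤ n) (σ : ZMod (n + 1) → ℝ) (i : ZMod (n + 1)) :
    ∑ t, affA n i t * σ t = 2 * σ i - σ (i + 1) - σ (i - 1) := by
  have h1 : (1 : ZMod (n + 1)) ≠ 0 := by
    have : Fact (1 < n + 1) := ⟨by omega⟩
    exact one_ne_zero
  have h2 : (1 + 1 : ZMod (n + 1)) ≠ 0 := by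
    intro h
    have h' : ((2 : ℕ) : ZMod (n + 1)) = 0 := by
      push_cast
      rw [← one_add_one_eq_two]
      exact h
    rw [ZMod.natCast_eq_zero_iff] at h'
    have := Nat.le_of_dvd (by norm_num) h'
    omega
  have h : ∀ t, affA n i t * σ t = (if t = i then 2 * σ t else 0)
      - (if t = i + 1 then σ t else 0) - (if t = i - 1 then σ t else 0) := by
    intro t
    have ht : i = t + 1 ↔ t = i - 1 := by rw [eq_sub_iff_add_eq, eq_comm]
    have e1 : i ≠ i + 1 := by simpa using h1
    have e2 : i ≠ i - 1 := fun h => h1 (sub_eq_self.mp h.symm)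
    have e3 : i + 1 ≠ i - 1 := by
      intro h
      apply h2
      linear_combination h
    unfold affA
    simp only [ht, eq_comm (a := i) (b := t)]
    by_cases c1 : t = i
    · subst c1
      simp [e1, e2]
    · by_cases c2 : t = i + 1
      · subst c2
        simp [c1, e3]
      · by_cases c3 : t = i - 1 <;> simp [c1, c2, c3, e2.symm, e3.symm]
  simp only [h, sum_sub_distrib, sum_ite_eq', mem_univ, if_true]

lemma reflA_apply (n : ℕ) (hn : 2 ≤ n) (μ σ : ZMod (n + 1) → ℝ) (i j : ZMod (n + 1)) :
    reflA n μ i σ j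
      = σ j + if j = i then 2 * μ i - 2 * σ i + σ (i + 1) + σ (i - 1) else 0 := by
  unfold reflA
  rw [sum_affA_mul n hn, Function.update_apply]
  split_ifs with h
  · rw [h]
    ring
  · ring

/-- Every element of `Γ_A(μ)` satisfies the type-A Pohozaev identity
`∑ σ_i² - ∑ σ_i σ_{i+1} = 2 ∑ μ_i σ_i` (indices cyclic mod `n+1`). -/
theorem gammaA_pohozaev (n : ℕ) (hn : 2 ≤ n) (μ σ : ZMod (n + 1) → ℝ)
    (hσ : GammaA n μ σ) :
    ∑ i : ZMod (n + 1), (σ i) ^ 2 - ∑ i : ZMod (n + 1), σ i * σ (i + 1)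
      = 2 * ∑ i : ZMod (n + 1), μ i * σ i := by
  have h1 : (1 : ZMod (n + 1)) ≠ 0 := by
    have : Fact (1 < n + 1) := ⟨by omega⟩
    exact one_ne_zero
  induction hσ with
  | zero => simp
  | refl i σ _ ih =>
    simp only [reflA_apply n hn]
    rw [sum_sq_add_single, sum_mul_add_single, sum_mul_shift_add_single σ i 1 h1]
    linear_combination ih
end

section
/- Let n ≥ 2, μ ∈ ℝ^{n+1}, σ ∈ Γ_A(μ), and set μ*_s = μ_s − (1/2)∑_{t∈I} K_{st} σ_t for s ∈ I. Let 1 ≤ r_1 < r_2 − 1 ≤ n and J_0 = {r_2, r_2+1, …, n+1} ∪ {1, 2, …, r_1}, relabelled as J_0 = {s_1, …, s_{|J_0|}} with s_1 = r_2, …, s_{n+2−r_2} = n+1, s_{n+3−r_2} = 1, …, s_{|J_0|} = r_1, where |J_0| = n + 2 − r_2 + r_1. Suppose I = N ⊔ J_0 ⊔ J_1 ⊔ … ⊔ J_ϑ (ϑ ≥ 0), where each J_p = {i_p, …, i_p + l_p} (p ≥ 1, with i_p + l_p ≤ n+1) is non-wrapping, all the sets are pairwise disjoint, N ≠ ∅,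 and every J_p (p = 0, 1, …, ϑ) has both of its cyclic neighbors in N (in particular r_1 + 1 ∈ N and r_2 − 1 ∈ N). Let (k_0^{s_i s_j})_{1≤i,j≤|J_0|} be the inverse of the matrix (K_{s_i s_j})_{1≤i,j≤|J_0|}, and for p ≥ 1 let (k_p^{ij})_{i,j∈J_p} be the inverse of (K_{ij})_{i,j∈J_p}. Define σ*_i = σ_i for i ∈ N; σ*_i = σ_i + 2∑_{j∈J_p} k_p^{ij}(μ*_j + μ*_{j_p*}) with j_p* = 2i_p + l_p − j for i ∈ J_p, p ≥ 1; and σ*_{s_i} = σ_{s_i} + 2∑_{j=1}^{|J_0|} k_0^{s_i s_j}(μ*_{s_j} + μ*_{s_{1+|J_0|−j}}) for 1 ≤ i ≤ |J_0|. Then σ* ∈ Γ_A(μ). -/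
open Finset

/-- The wrapped block `J_0 = {r_2, r_2+1, …, n+1} ∪ {1, 2, …, r_1}`. -/
def J0set (n r1 r2 : ℕ) : Finset ℕ := Finset.Icc r2 (n + 1) ∪ Finset.Icc 1 r1

/-- The relabelling `s_i` of `J_0`: `s_i = r_2 + i - 1` for `1 ≤ i ≤ n+2-r_2`
and `s_i = i - (n+2-r_2)` for `n+3-r_2 ≤ i ≤ |J_0|`. -/
def sIdx (n r1 r2 i : ℕ) : ℕ :=
  if i ≤ n + 2 - r2 then r2 + i - 1 else i - (n + 2 - r2)

/-- `N = I \ (J_0 ∪ J_1 ∪ ⋯ ∪ J_ϑ)`. -/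
def NsetA0 (n r1 r2 ϑ : ℕ) (ip lp : ℕ → ℕ) : Finset ℕ :=
  Finset.Icc 1 (n + 1) \
    (J0set n r1 r2 ∪ (Finset.Icc 1 ϑ).biUnion (fun p => Finset.Icc (ip p) (ip p + lp p)))

/-- The vector `μ*` attached to `σ`, as a function on the cyclic index set. -/
noncomputable def muStar (n : ℕ) (μ σ : ZMod (n + 1) → ℝ) (s : ZMod (n + 1)) : ℝ :=
  μ s - (1 / 2) * ∑ t : ZMod (n + 1), affA n s t * σ t

lemma affA_self (n : ℕ) (i : ZMod (n + 1)) : affA n i i = 2 := by simp [affA]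

lemma affA_comm (n : ℕ) (i j : ZMod (n + 1)) : affA n i j = affA n j i := by
  simp only [affA, eq_comm (a := i) (b := j), or_comm (a := i = j + 1)]

lemma reflA_eq (n : ℕ) (μ σ : ZMod (n + 1) → ℝ) (i : ZMod (n + 1)) :
    reflA n μ i σ = σ + Pi.single i (2 * muStar n μ σ i) := by
  ext j
  by_cases h : j = i
  · subst h
    simp [reflA, muStar]
    ring
  · simp [reflA, h]

lemma muStar_reflA (n : ℕ) (μ σ : ZMod (n + 1) → ℝ) (i j : ZMod (n + 1)) :
    muStar n μ (reflA n μ i σ) j = muStar n μ σ j - affA n j i * muStar n μ σ i := by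
  rw [reflA_eq]
  generalize muStar n μ σ i = x
  simp [muStar, mul_add, Finset.sum_add_distrib, Pi.single_apply]
  ring

lemma natCast_zmod_inj {n i j : ℕ} (hi : i ≤ n) (hj : j ≤ n)
    (h : (i : ZMod (n + 1)) = j) : i = j := by
  rw [ZMod.natCast_eq_natCast_iff'] at h
  rwa [Nat.mod_eq_of_lt (by omega), Nat.mod_eq_of_lt (by omega)] at h

lemma affA_add_natCast {n i j : ℕ} (hi : i < n) (hj : j < n) (a : ZMod (n + 1)) :
    affA n (a + i) (a + j) = if i = j then 2 else if i = j + 1 ∨ j = i + 1 then -1 else 0 := by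
  have h1 : (a + i = a + j) ↔ i = j :=
    ⟨fun h => natCast_zmod_inj hi.le hj.le (add_left_cancel h), fun h => by rw [h]⟩
  have h2 : ∀ {i j : ℕ}, i < n → j < n → ((a + i = a + j + 1) ↔ i = j + 1) := by
    intro i j hi hj
    refine ⟨fun h => natCast_zmod_inj hi.le hj ?_, fun h => by rw [h]; push_cast; ring⟩
    push_cast
    rw [add_assoc] at h
    exact add_left_cancel h
  simp only [affA, h1, h2 hi hj, h2 hj hi]

/-- If `μ*` on a block of consecutive indices is the sequence of consecutive differences of `z`,
the reflection at the `i`-th index of the block swaps two adjacent values of `z`. -/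
lemma muStar_reflA_block {n m : ℕ} (hm : m ≤ n) (μ σ : ZMod (n + 1) → ℝ) (a : ZMod (n + 1))
    (z : Fin (m + 1) → ℝ)
    (hz : ∀ j : Fin m, muStar n μ σ (a + (j : ℕ)) = z j.succ - z j.castSucc) (i j : Fin m) :
    muStar n μ (reflA n μ (a + (i : ℕ)) σ) (a + (j : ℕ)) =
      z (Equiv.swap i.castSucc i.succ j.succ) - z (Equiv.swap i.castSucc i.succ j.castSucc) := by
  rw [muStar_reflA, hz, hz, affA_add_natCast (by omega) (by omega)]
  rcases lt_trichotomy (i : ℕ) j with h | h | h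
  · rw [if_neg (by omega), Equiv.swap_apply_of_ne_of_ne (x := j.succ)
      (by simp [Fin.ext_iff]; omega) (by simp [Fin.ext_iff]; omega)]
    by_cases h' : (j : ℕ) = i + 1
    · have : j.castSucc = i.succ := by ext; simpa using h'
      rw [this, Equiv.swap_apply_right, if_pos (Or.inl h')]
      ring
    · rw [if_neg (by omega), Equiv.swap_apply_of_ne_of_ne
        (by simp [Fin.ext_iff]; omega) (by simp [Fin.ext_iff]; omega)]
      ring
  · obtain rfl : i = j := Fin.ext h
    simp
    ring
  · rw [if_neg (by omega), Equiv.swap_apply_of_ne_of_ne (x := j.castSucc)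
      (by simp [Fin.ext_iff]; omega) (by simp [Fin.ext_iff]; omega)]
    by_cases h' : (i : ℕ) = j + 1
    · have : j.succ = i.castSucc := by ext; simpa using h'.symm
      rw [this, Equiv.swap_apply_left, if_pos (Or.inr h')]
      ring
    · rw [if_neg (by omega), Equiv.swap_apply_of_ne_of_ne
        (by simp [Fin.ext_iff]; omega) (by simp [Fin.ext_iff]; omega)]
      ring

lemma GammaA.exists_perm {n m : ℕ} (hm : m ≤ n) {μ σ : ZMod (n + 1) → ℝ} (hσ : GammaA n μ σ)
    (a : ZMod (n + 1)) (z : Fin (m + 1) → ℝ)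
    (hz : ∀ j : Fin m, muStar n μ σ (a + (j : ℕ)) = z j.succ - z j.castSucc)
    (π : Equiv.Perm (Fin (m + 1))) :
    ∃ τ, GammaA n μ τ ∧ (∀ x, (∀ j : ℕ, j < m → x ≠ a + j) → τ x = σ x) ∧
      ∀ j : Fin m, muStar n μ τ (a + (j : ℕ)) = z (π j.succ) - z (π j.castSucc) := by
  have hπ : π ∈ Submonoid.closure
      (Set.range fun i : Fin m => Equiv.swap i.castSucc i.succ) := by
    rw [Equiv.Perm.mclosure_swap_castSucc_succ]
    trivial
  induction hπ using Submonoid.closure_induction_right with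
  | one => exact ⟨σ, hσ, fun _ _ => rfl, hz⟩
  | mul_right π _ s hs ih =>
    obtain ⟨i, rfl⟩ := hs
    obtain ⟨τ, hτ, hoff, hτz⟩ := ih
    refine ⟨reflA n μ (a + (i : ℕ)) τ, hτ.refl _ _, fun x hx => ?_,
      fun j => muStar_reflA_block hm μ τ a (z ∘ π) hτz i j⟩
    rw [← hoff x hx, reflA, Function.update_of_ne (hx i i.2)]

/-- The longest element of the finite Weyl group of a block negates and reverses `μ*`
on that block. -/
lemma GammaA.exists_reverse {n m : ℕ} (hm : m ≤ n) {μ σ : ZMod (n + 1) → ℝ}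
    (hσ : GammaA n μ σ) (a : ZMod (n + 1)) :
    ∃ τ, GammaA n μ τ ∧ (∀ x, (∀ j : ℕ, j < m → x ≠ a + j) → τ x = σ x) ∧
      ∀ j < m, muStar n μ τ (a + (j : ℕ)) = -muStar n μ σ (a + (m - 1 - j : ℕ)) := by
  obtain ⟨τ, hτ, hoff, h⟩ := hσ.exists_perm hm a
    (fun k => ∑ i ∈ range (k : ℕ), muStar n μ σ (a + (i : ℕ)))
    (fun j => by simp [Finset.sum_range_succ]) Fin.revPerm
  refine ⟨τ, hτ, hoff, fun j hj => ?_⟩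
  have := h ⟨j, hj⟩
  simp only [Fin.revPerm_apply, Fin.val_rev, Fin.val_succ, Fin.val_castSucc] at this
  rw [this, show m + 1 - (j + 1) = m - 1 - j + 1 by omega,
    show m + 1 - (j + 1 + 1) = m - 1 - j by omega, Finset.sum_range_succ]
  ring

lemma muStar_sub_of_eq_off_block {n m : ℕ} (hm : m ≤ n) {μ σ τ : ZMod (n + 1) → ℝ}
    {a : ZMod (n + 1)} (hoff : ∀ x, (∀ j : ℕ, j < m → x ≠ a + j) → τ x = σ x)
    (s : ZMod (n + 1)) :
    2 * (muStar n μ σ s - muStar n μ τ s) =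
      ∑ u ∈ range m, affA n s (a + u) * (τ (a + u) - σ (a + u)) := by
  have hinj : Set.InjOn (fun u : ℕ => a + (u : ZMod (n + 1))) (range m : Set ℕ) := by
    intro u hu v hv h
    simp only [coe_range, Set.mem_Iio] at hu hv
    exact natCast_zmod_inj (by omega) (by omega) (add_left_cancel h)
  rw [← Finset.sum_image (f := fun x => affA n s x * (τ x - σ x)) hinj,
    Finset.sum_subset (Finset.subset_univ _)]
  · simp only [muStar, mul_sub, Finset.sum_sub_distrib]
    ring
  · intro x _ hx
    rw [hoff x fun j hj h => hx (Finset.mem_image.2 ⟨j, Finset.mem_range.2 hj, h.symm⟩)]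
    simp

lemma GammaA.block_step {n m : ℕ} (hm : m ≤ n) {μ σ τ : ZMod (n + 1) → ℝ}
    (hσ : GammaA n μ σ) (a : ZMod (n + 1)) (k : ℕ → ℕ → ℝ)
    (hk : ∀ i < m, ∀ u < m,
      ∑ t ∈ range m, k i t * affA n (a + t) (a + u) = if i = u then 1 else 0)
    (hoff : ∀ x, (∀ j : ℕ, j < m → x ≠ a + j) → τ x = σ x)
    (hτ : ∀ i < m, τ (a + (i : ℕ)) = σ (a + (i : ℕ)) +
      2 * ∑ j ∈ range m, k i j * (muStar n μ σ (a + j) + muStar n μ σ (a + (m - 1 - j : ℕ)))) :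
    GammaA n μ τ := by
  obtain ⟨τ', hτ', hoff', h⟩ := hσ.exists_reverse hm a
  suffices τ = τ' by rwa [this]
  ext x
  by_cases hx : ∃ j : ℕ, j < m ∧ x = a + j
  · obtain ⟨i, hi, rfl⟩ := hx
    rw [hτ i hi, Finset.mul_sum]
    have : ∀ j ∈ range m, 2 * (k i j * (muStar n μ σ (a + j) +
        muStar n μ σ (a + (m - 1 - j : ℕ)))) =
        ∑ u ∈ range m, k i j * affA n (a + j) (a + u) * (τ' (a + u) - σ (a + u)) := by
      intro j hj
      have e := muStar_sub_of_eq_off_block (μ := μ) hm hoff' (a + j)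
      rw [h j (Finset.mem_range.1 hj)] at e
      simp only [mul_assoc]
      rw [← Finset.mul_sum, ← e]
      ring
    rw [Finset.sum_congr rfl this, Finset.sum_comm]
    simp only [← Finset.sum_mul]
    rw [Finset.sum_congr rfl fun u hu => by rw [hk i hi u (Finset.mem_range.1 hu)]]
    simp [hi]
  · push Not at hx
    rw [hoff x hx, hoff' x hx]

lemma GammaA.blocks_step {ι : Type*} [DecidableEq ι] {n : ℕ} {μ σ : ZMod (n + 1) → ℝ}
    (hσ : GammaA n μ σ) (S : Finset ι) (a : ι → ZMod (n + 1)) (m : ι → ℕ)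
    (hm : ∀ p ∈ S, m p ≤ n) (k : ι → ℕ → ℕ → ℝ)
    (hk : ∀ p ∈ S, ∀ i < m p, ∀ u < m p,
      ∑ t ∈ range (m p), k p i t * affA n (a p + t) (a p + u) = if i = u then 1 else 0)
    (hsep : ∀ p ∈ S, ∀ q ∈ S, p ≠ q → ∀ i < m p, ∀ j < m q,
      affA n (a p + (i : ℕ)) (a q + (j : ℕ)) = 0)
    (τ : ZMod (n + 1) → ℝ)
    (hoff : ∀ x, (∀ p ∈ S, ∀ j < m p, x ≠ a p + (j : ℕ)) → τ x = σ x)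
    (hτ : ∀ p ∈ S, ∀ i < m p, τ (a p + (i : ℕ)) = σ (a p + (i : ℕ)) +
      2 * ∑ j ∈ range (m p),
        k p i j * (muStar n μ σ (a p + j) + muStar n μ σ (a p + (m p - 1 - j : ℕ)))) :
    GammaA n μ τ := by
  classical
  induction S using Finset.induction_on generalizing τ with
  | empty =>
    obtain rfl : τ = σ := funext fun x => hoff x (by simp)
    exact hσ
  | insert p S hp ih =>
    have hdisj : ∀ q ∈ S, ∀ i < m p, ∀ j < m q, a q + ((j : ℕ) : ZMod (n + 1)) ≠ a p + (i : ℕ) := by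
      intro q hq i hi j hj h
      have := hsep p (by simp) q (by simp [hq]) (by rintro rfl; exact hp hq) i hi j hj
      rw [h, affA_self] at this
      norm_num at this
    set τ' : ZMod (n + 1) → ℝ :=
      fun x => if ∃ j : ℕ, j < m p ∧ x = a p + j then σ x else τ x with hτ'
    have hin : ∀ i < m p, τ' (a p + (i : ℕ)) = σ (a p + (i : ℕ)) := fun i hi =>
      if_pos ⟨i, hi, rfl⟩
    have hout : ∀ x, (∀ j : ℕ, j < m p → x ≠ a p + j) → τ' x = τ x := fun x hx =>
      if_neg (by push Not; exact hx)
    have hΓ : GammaA n μ τ' := by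
      refine ih (fun q hq => hm q (by simp [hq])) (fun q hq => hk q (by simp [hq]))
        (fun q hq r hr => hsep q (by simp [hq]) r (by simp [hr])) τ' (fun x hx => ?_)
        (fun q hq i hi => ?_)
      · by_cases h : ∃ j : ℕ, j < m p ∧ x = a p + j
        · exact if_pos h
        · push Not at h
          rw [hout x h]
          refine hoff x fun q hq => ?_
          rcases Finset.mem_insert.1 hq with rfl | hq
          exacts [h, hx q hq]
      · rw [hout _ fun j hj => hdisj q hq j hj i hi]
        exact hτ q (by simp [hq]) i hi
    have hmu : ∀ i < m p, muStar n μ τ' (a p + (i : ℕ)) = muStar n μ σ (a p + (i : ℕ)) := by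
      intro i hi
      unfold muStar
      congr 2
      refine Finset.sum_congr rfl fun t _ => ?_
      by_cases h : ∃ q ∈ S, ∃ j < m q, t = a q + (j : ℕ)
      · obtain ⟨q, hq, j, hj, rfl⟩ := h
        rw [hsep p (by simp) q (by simp [hq]) (by rintro rfl; exact hp hq) i hi j hj]
        simp
      · push Not at h
        by_cases h' : ∃ j : ℕ, j < m p ∧ t = a p + j
        · obtain ⟨j, hj, rfl⟩ := h'
          rw [hin j hj]
        · push Not at h'
          rw [hout t h', hoff t]
          intro q hq
          rcases Finset.mem_insert.1 hq with rfl | hq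
          exacts [h', h q hq]
    refine hΓ.block_step (hm p (by simp)) (a p) (k p) (hk p (by simp))
      (fun x hx => (hout x hx).symm) fun i hi => ?_
    rw [hτ p (by simp) i hi, hin i hi]
    congr 2
    refine Finset.sum_congr rfl fun j hj => ?_
    have := Finset.mem_range.1 hj
    rw [hmu j this, hmu _ (by omega)]

/-- The cyclic successor on `{1, …, n + 1}`. -/
def cyclicSucc (n t : ℕ) : ℕ := if t = n + 1 then 1 else t + 1

lemma natCast_zmod_inj_of_mem_Icc {n s t : ℕ} (hs : s ∈ Icc 1 (n + 1)) (ht : t ∈ Icc 1 (n + 1))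
    (h : (s : ZMod (n + 1)) = t) : s = t := by
  rw [Finset.mem_Icc] at hs ht
  have : s - 1 = t - 1 := natCast_zmod_inj (n := n) (by omega) (by omega) (by
    rw [Nat.cast_sub hs.1, Nat.cast_sub ht.1, h])
  omega

lemma natCast_cyclicSucc (n t : ℕ) : (cyclicSucc n t : ZMod (n + 1)) = t + 1 := by
  unfold cyclicSucc
  split_ifs with h
  · subst h
    have := ZMod.natCast_self (n + 1)
    rw [this]
    simp
  · simp

lemma cyclicSucc_mem_Icc {n t : ℕ} (ht : t ∈ Icc 1 (n + 1)) : cyclicSucc n t ∈ Icc 1 (n + 1) := by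
  unfold cyclicSucc
  rw [Finset.mem_Icc] at ht ⊢
  split_ifs <;> omega

lemma exists_natCast_zmod_eq {n : ℕ} (x : ZMod (n + 1)) :
    ∃ s ∈ Icc 1 (n + 1), (s : ZMod (n + 1)) = x :=
  ⟨cyclicSucc n (x - 1).val, by
    have := ZMod.val_lt (x - 1)
    unfold cyclicSucc
    rw [Finset.mem_Icc]
    split_ifs <;> omega, by rw [natCast_cyclicSucc]; simp⟩

lemma affA_eq_zero_of_disjoint {n : ℕ} {J J' N : Finset ℕ} (hJ : J ⊆ Icc 1 (n + 1))
    (hJ' : J' ⊆ Icc 1 (n + 1)) (hd : Disjoint J J') (hN : Disjoint N (J ∪ J'))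
    (hs : ∀ t ∈ J, cyclicSucc n t ∈ J ∪ N) (hs' : ∀ t ∈ J', cyclicSucc n t ∈ J' ∪ N)
    {s t : ℕ} (hsJ : s ∈ J) (htJ : t ∈ J') : affA n s t = 0 := by
  rw [Finset.disjoint_union_right] at hN
  have h1 : (s : ZMod (n + 1)) ≠ t := fun h => by
    have := natCast_zmod_inj_of_mem_Icc (hJ hsJ) (hJ' htJ) h
    subst this
    exact Finset.disjoint_left.1 hd hsJ htJ
  have h2 : (s : ZMod (n + 1)) ≠ t + 1 := fun h => by
    rw [← natCast_cyclicSucc] at h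
    have := natCast_zmod_inj_of_mem_Icc (hJ hsJ) (cyclicSucc_mem_Icc (hJ' htJ)) h
    subst this
    rcases Finset.mem_union.1 (hs' t htJ) with h | h
    exacts [Finset.disjoint_left.1 hd hsJ h, Finset.disjoint_left.1 hN.1 h hsJ]
  have h3 : (t : ZMod (n + 1)) ≠ s + 1 := fun h => by
    rw [← natCast_cyclicSucc] at h
    have := natCast_zmod_inj_of_mem_Icc (hJ' htJ) (cyclicSucc_mem_Icc (hJ hsJ)) h
    subst this
    rcases Finset.mem_union.1 (hs s hsJ) with h | h
    exacts [Finset.disjoint_left.1 hd h htJ, Finset.disjoint_left.1 hN.2 h htJ]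
  simp [affA, h1, h2, h3]

lemma natCast_sIdx {n r1 r2 : ℕ} (hr2 : r2 - 1 ≤ n) (k : ℕ) :
    (sIdx n r1 r2 (k + 1) : ZMod (n + 1)) = r2 + k := by
  unfold sIdx
  split_ifs with h
  · push_cast [← add_assoc, Nat.add_sub_cancel]
    rfl
  · have : (((k + 1 - (n + 2 - r2)) + (n + 1) : ℕ) : ZMod (n + 1)) = (r2 + k : ℕ) :=
      congrArg _ (by omega)
    rw [Nat.cast_add, ZMod.natCast_self, add_zero] at this
    rw [this, Nat.cast_add]

lemma sIdx_mem_J0set {n r1 r2 k : ℕ} (hk : k < n + 2 - r2 + r1) :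
    sIdx n r1 r2 (k + 1) ∈ J0set n r1 r2 := by
  simp only [sIdx, J0set, Finset.mem_union, Finset.mem_Icc]
  split_ifs <;> omega

lemma exists_sIdx_eq {n r1 r2 s : ℕ} (hs : s ∈ J0set n r1 r2) :
    ∃ k < n + 2 - r2 + r1, sIdx n r1 r2 (k + 1) = s := by
  simp only [J0set, Finset.mem_union, Finset.mem_Icc] at hs
  rcases hs with hs | hs
  · refine ⟨s - r2, by omega, ?_⟩
    rw [sIdx, if_pos (by omega)]
    omega
  · refine ⟨s + (n + 2 - r2) - 1, by omega, ?_⟩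
    rw [sIdx, if_neg (by omega)]
    omega

lemma sum_Icc_eq_sum_range (f : ℕ → ℝ) (a l : ℕ) :
    ∑ j ∈ Icc a (a + l), f j = ∑ j ∈ range (l + 1), f (a + j) := by
  have : Icc a (a + l) = Ico a (a + l + 1) := by
    ext
    simp only [Finset.mem_Icc, Finset.mem_Ico]
    omega
  rw [this, Finset.sum_Ico_eq_sum_range, show a + l + 1 - a = l + 1 by omega]

lemma sum_Icc_one_eq_sum_range (f : ℕ → ℝ) (m : ℕ) :
    ∑ j ∈ Icc 1 m, f j = ∑ j ∈ range m, f (j + 1) := by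
  have : Icc 1 m = Ico 1 (m + 1) := by
    ext
    simp only [Finset.mem_Icc, Finset.mem_Ico]
    omega
  rw [this, Finset.sum_Ico_eq_sum_range]
  simp [add_comm]

/-- Alternative (II): `I = N ⊔ J_0 ⊔ J_1 ⊔ ⋯ ⊔ J_ϑ`, where `J_0` is the wrapped block
`{r_2,…,n+1,1,…,r_1}` relabelled by `s_1,…,s_{|J_0|}` and the `J_p` (`p ≥ 1`) are
non-wrapping consecutive blocks; all blocks have their cyclic neighbors in `N ≠ ∅`.
If `σ ∈ Γ_A(μ)` and `σ*` is obtained by the blockwise updates (using the inverses of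
the corresponding submatrices of `K`), then `σ* ∈ Γ_A(μ)`. -/
theorem gammaA_wrapped_blockwise_step (n : ℕ) (hn : 2 ≤ n) (μ σ : ZMod (n + 1) → ℝ)
    (hσ : GammaA n μ σ)
    (μstar : ℕ → ℝ)
    (hμstar : ∀ s : ℕ, μstar s =
      μ (s : ZMod (n + 1)) - (1 / 2) * ∑ t : ZMod (n + 1), affA n (s : ZMod (n + 1)) t * σ t)
    (r1 r2 : ℕ) (hr1 : 1 ≤ r1) (hr12 : r1 < r2 - 1) (hr2 : r2 - 1 ≤ n)
    (ϑ : ℕ) (ip lp : ℕ → ℕ)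
    (hblk : ∀ p ∈ Finset.Icc 1 ϑ, 1 ≤ ip p ∧ ip p + lp p ≤ n + 1)
    (hdisj : ∀ p ∈ Finset.Icc 1 ϑ, ∀ q ∈ Finset.Icc 1 ϑ, p ≠ q →
      Disjoint (Finset.Icc (ip p) (ip p + lp p)) (Finset.Icc (ip q) (ip q + lp q)))
    (hdisj0 : ∀ p ∈ Finset.Icc 1 ϑ,
      Disjoint (Finset.Icc (ip p) (ip p + lp p)) (J0set n r1 r2))
    (hNne : (NsetA0 n r1 r2 ϑ ip lp).Nonempty)
    (hnbhd0 : r1 + 1 ∈ NsetA0 n r1 r2 ϑ ip lp ∧ r2 - 1 ∈ NsetA0 n r1 r2 ϑ ip lp)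
    (hnbhd : ∀ p ∈ Finset.Icc 1 ϑ,
      (if ip p = 1 then n + 1 else ip p - 1) ∈ NsetA0 n r1 r2 ϑ ip lp ∧
      (if ip p + lp p = n + 1 then 1 else ip p + lp p + 1) ∈ NsetA0 n r1 r2 ϑ ip lp)
    (kinv0 : ℕ → ℕ → ℝ)
    (hkinv01 : ∀ i ∈ Finset.Icc 1 (n + 2 - r2 + r1), ∀ u ∈ Finset.Icc 1 (n + 2 - r2 + r1),
      ∑ t ∈ Finset.Icc 1 (n + 2 - r2 + r1),
        affA n ((sIdx n r1 r2 i : ℕ) : ZMod (n + 1)) ((sIdx n r1 r2 t : ℕ) : ZMod (n + 1)) *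
          kinv0 t u
        = if i = u then 1 else 0)
    (hkinv02 : ∀ i ∈ Finset.Icc 1 (n + 2 - r2 + r1), ∀ u ∈ Finset.Icc 1 (n + 2 - r2 + r1),
      ∑ t ∈ Finset.Icc 1 (n + 2 - r2 + r1),
        kinv0 i t *
          affA n ((sIdx n r1 r2 t : ℕ) : ZMod (n + 1)) ((sIdx n r1 r2 u : ℕ) : ZMod (n + 1))
        = if i = u then 1 else 0)
    (kinv : ℕ → ℕ → ℕ → ℝ)
    (hkinv1 : ∀ p ∈ Finset.Icc 1 ϑ, ∀ s ∈ Finset.Icc (ip p) (ip p + lp p),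
      ∀ u ∈ Finset.Icc (ip p) (ip p + lp p),
      ∑ t ∈ Finset.Icc (ip p) (ip p + lp p),
        affA n (s : ZMod (n + 1)) (t : ZMod (n + 1)) * kinv p t u
        = if s = u then 1 else 0)
    (hkinv2 : ∀ p ∈ Finset.Icc 1 ϑ, ∀ s ∈ Finset.Icc (ip p) (ip p + lp p),
      ∀ u ∈ Finset.Icc (ip p) (ip p + lp p),
      ∑ t ∈ Finset.Icc (ip p) (ip p + lp p),
        kinv p s t * affA n (t : ZMod (n + 1)) (u : ZMod (n + 1))
        = if s = u then 1 else 0)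
    (σstar : ZMod (n + 1) → ℝ)
    (hσstar1 : ∀ s ∈ NsetA0 n r1 r2 ϑ ip lp,
      σstar (s : ZMod (n + 1)) = σ (s : ZMod (n + 1)))
    (hσstar2 : ∀ p ∈ Finset.Icc 1 ϑ, ∀ i ∈ Finset.Icc (ip p) (ip p + lp p),
      σstar (i : ZMod (n + 1)) = σ (i : ZMod (n + 1)) +
        2 * ∑ j ∈ Finset.Icc (ip p) (ip p + lp p),
          kinv p i j * (μstar j + μstar (2 * ip p + lp p - j)))
    (hσstar0 : ∀ i ∈ Finset.Icc 1 (n + 2 - r2 + r1),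
      σstar ((sIdx n r1 r2 i : ℕ) : ZMod (n + 1)) =
        σ ((sIdx n r1 r2 i : ℕ) : ZMod (n + 1)) +
          2 * ∑ j ∈ Finset.Icc 1 (n + 2 - r2 + r1),
            kinv0 i j * (μstar (sIdx n r1 r2 j) +
              μstar (sIdx n r1 r2 (1 + (n + 2 - r2 + r1) - j)))) :
    GammaA n μ σstar := by
  set N := NsetA0 n r1 r2 ϑ ip lp with hN
  have hmu : ∀ s : ℕ, μstar s = muStar n μ σ s := hμstar
  set J : ℕ → Finset ℕ := fun p =>
    if p = 0 then J0set n r1 r2 else Icc (ip p) (ip p + lp p) with hJ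
  set a : ℕ → ZMod (n + 1) := fun p => if p = 0 then (r2 : ZMod (n + 1)) else ip p with ha
  set m : ℕ → ℕ := fun p => if p = 0 then n + 2 - r2 + r1 else lp p + 1 with hm
  have hpos : ∀ p ∈ range (ϑ + 1), p ≠ 0 → p ∈ Icc 1 ϑ := fun p hp hp0 => by
    simp only [Finset.mem_range, Finset.mem_Icc] at hp ⊢
    omega
  have hone : 1 ∈ J0set n r1 r2 := by
    simp only [J0set, Finset.mem_union, Finset.mem_Icc]
    omega
  have hJN : ∀ p ∈ range (ϑ + 1), Disjoint N (J p) := by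
    intro p hp
    refine Finset.disjoint_left.2 fun x hx hxp => (Finset.mem_sdiff.1 hx).2 ?_
    by_cases hp0 : p = 0
    · simp only [hJ, hp0, if_true] at hxp
      exact Finset.mem_union_left _ hxp
    · simp only [hJ, hp0, if_false] at hxp
      exact Finset.mem_union_right _ (Finset.mem_biUnion.2 ⟨p, hpos p hp hp0, hxp⟩)
  have hJI : ∀ p ∈ range (ϑ + 1), J p ⊆ Icc 1 (n + 1) := by
    intro p hp x hx
    by_cases hp0 : p = 0
    · simp only [hJ, hp0, if_true, J0set, Finset.mem_union, Finset.mem_Icc] at hx ⊢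
      omega
    · have := hblk p (hpos p hp hp0)
      simp only [hJ, hp0, if_false, Finset.mem_Icc] at hx ⊢
      omega
  have hJJ : ∀ p ∈ range (ϑ + 1), ∀ q ∈ range (ϑ + 1), p ≠ q → Disjoint (J p) (J q) := by
    intro p hp q hq hpq
    by_cases hp0 : p = 0
    · have hq0 : q ≠ 0 := by omega
      simpa only [hJ, hp0, hq0, if_true, if_false] using (hdisj0 q (hpos q hq hq0)).symm
    · by_cases hq0 : q = 0
      · simpa only [hJ, hp0, hq0, if_true, if_false] using hdisj0 p (hpos p hp hp0)
      · simpa only [hJ, hp0, hq0, if_false] using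
          hdisj p (hpos p hp hp0) q (hpos q hq hq0) hpq
  have hsucc : ∀ p ∈ range (ϑ + 1), ∀ t ∈ J p, cyclicSucc n t ∈ J p ∪ N := by
    intro p hp t ht
    by_cases hp0 : p = 0
    · simp only [hJ, hp0, if_true] at ht ⊢
      by_cases h : t = r1
      · refine Finset.mem_union_right _ ?_
        rw [cyclicSucc, if_neg (by omega), h]
        exact hnbhd0.1
      · refine Finset.mem_union_left _ ?_
        simp only [J0set, Finset.mem_union, Finset.mem_Icc, cyclicSucc] at ht ⊢
        split_ifs <;> omega
    · simp only [hJ, hp0, if_false] at ht ⊢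
      by_cases h : t = ip p + lp p
      · subst h
        exact Finset.mem_union_right _ (hnbhd p (hpos p hp hp0)).2
      · refine Finset.mem_union_left _ ?_
        have := hblk p (hpos p hp hp0)
        simp only [Finset.mem_Icc, cyclicSucc] at ht ⊢
        split_ifs <;> omega
  have hmem : ∀ p ∈ range (ϑ + 1), ∀ k < m p, ∃ s ∈ J p, (s : ZMod (n + 1)) = a p + (k : ℕ) := by
    intro p hp k hk
    by_cases hp0 : p = 0
    · simp only [hJ, ha, hm, hp0, if_true] at hk ⊢
      exact ⟨_, sIdx_mem_J0set hk, natCast_sIdx hr2 k⟩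
    · simp only [hJ, ha, hm, hp0, if_false] at hk ⊢
      exact ⟨ip p + k, by rw [Finset.mem_Icc]; omega, by push_cast; rfl⟩
  have hmem' : ∀ p ∈ range (ϑ + 1), ∀ s ∈ J p, ∃ k < m p, (s : ZMod (n + 1)) = a p + (k : ℕ) := by
    intro p hp s hs
    by_cases hp0 : p = 0
    · simp only [hJ, ha, hm, hp0, if_true] at hs ⊢
      obtain ⟨k, hk, rfl⟩ := exists_sIdx_eq hs
      exact ⟨k, hk, natCast_sIdx hr2 k⟩
    · simp only [hJ, ha, hm, hp0, if_false, Finset.mem_Icc] at hs ⊢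
      refine ⟨s - ip p, by omega, ?_⟩
      rw [← Nat.cast_add, Nat.add_sub_cancel' hs.1]
  refine hσ.blocks_step (range (ϑ + 1)) a m ?_
    (fun p i j => if p = 0 then kinv0 (i + 1) (j + 1) else kinv p (ip p + i) (ip p + j))
    ?_ ?_ σstar ?_ ?_
  · intro p hp
    by_cases hp0 : p = 0
    · simp only [hm, hp0, if_true]
      omega
    · simp only [hm, hp0, if_false]
      have h1 := hblk p (hpos p hp hp0)
      have h2 : ip p ≠ 1 := fun h => Finset.disjoint_left.1 (hdisj0 p (hpos p hp hp0))
        (Finset.mem_Icc.2 ⟨h.le, by omega⟩) hone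
      omega
  · intro p hp i hi u hu
    by_cases hp0 : p = 0
    · simp only [ha, hm, hp0, if_true] at hi hu ⊢
      have := hkinv02 (i + 1) (by rw [Finset.mem_Icc]; omega) (u + 1)
        (by rw [Finset.mem_Icc]; omega)
      rw [sum_Icc_one_eq_sum_range] at this
      simpa only [natCast_sIdx hr2, Nat.add_right_cancel_iff] using this
    · simp only [ha, hm, hp0, if_false] at hi hu ⊢
      have := hkinv2 p (hpos p hp hp0) (ip p + i) (by rw [Finset.mem_Icc]; omega) (ip p + u)
        (by rw [Finset.mem_Icc]; omega)
      rw [sum_Icc_eq_sum_range] at this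
      simpa only [Nat.cast_add, Nat.add_left_cancel_iff] using this
  · intro p hp q hq hpq i hi j hj
    obtain ⟨s, hs, hs'⟩ := hmem p hp i hi
    obtain ⟨t, ht, ht'⟩ := hmem q hq j hj
    rw [← hs', ← ht']
    exact affA_eq_zero_of_disjoint (hJI p hp) (hJI q hq) (hJJ p hp q hq hpq)
      (Finset.disjoint_union_right.2 ⟨hJN p hp, hJN q hq⟩) (hsucc p hp) (hsucc q hq) hs ht
  · intro x hx
    obtain ⟨s, hs, rfl⟩ := exists_natCast_zmod_eq x
    have hsJ : ∀ p ∈ range (ϑ + 1), s ∉ J p := fun p hp hsp => by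
      obtain ⟨k, hk, h⟩ := hmem' p hp s hsp
      exact hx p hp k hk h
    refine hσstar1 s (Finset.mem_sdiff.2 ⟨hs, fun h => ?_⟩)
    rcases Finset.mem_union.1 h with h | h
    · exact hsJ 0 (by simp) (by simpa only [hJ, if_true] using h)
    · obtain ⟨p, hp, h⟩ := Finset.mem_biUnion.1 h
      rw [Finset.mem_Icc] at hp
      exact hsJ p (by rw [Finset.mem_range]; omega)
        (by simpa only [hJ, show p ≠ 0 by omega, if_false] using h)
  · intro p hp i hi
    by_cases hp0 : p = 0
    · simp only [ha, hm, hp0, if_true] at hi ⊢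
      have := hσstar0 (i + 1) (by rw [Finset.mem_Icc]; omega)
      rw [sum_Icc_one_eq_sum_range] at this
      simp only [natCast_sIdx hr2, hmu] at this
      rw [this]
      congr 2
      refine Finset.sum_congr rfl fun j hj => ?_
      rw [Finset.mem_range] at hj
      rw [show 1 + (n + 2 - r2 + r1) - (j + 1) = n + 2 - r2 + r1 - 1 - j + 1 by omega,
        natCast_sIdx hr2]
    · simp only [ha, hm, hp0, if_false] at hi ⊢
      have := hσstar2 p (hpos p hp hp0) (ip p + i) (by rw [Finset.mem_Icc]; omega)
      rw [sum_Icc_eq_sum_range] at this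
      simp only [hmu] at this
      rw [← Nat.cast_add, this]
      congr 2
      refine Finset.sum_congr rfl fun j hj => ?_
      rw [Finset.mem_range] at hj
      rw [show 2 * ip p + lp p - (ip p + j) = ip p + (lp p + 1 - 1 - j) by omega]
      simp only [Nat.cast_add]
end
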